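/- Let Ω : ℝ → ℂ be bounded on [−1,1] and differentiable at x = 1 and at x = −1. Then for every α > 0 and every irrational x ∈ (0,1), the series Σ_{j=1}^{∞} e^{(iπ/4) Σ_{ℓ=0}^{j−1} σ(T^ℓ(x))} (Π_{ℓ=0}^{j−1} |T^ℓ(x)|)^{α} · Ω(T^j(x)) converges (i.e., its partial sums converge). In particular this holds for Ω ≡ 1. -/

import Mathlib

open Complex Filter Finset

noncomputable section

/-- `ρ = e^{iπ/4}`. -/
def ρ : ℂ := Complex.exp (Real.pi * Complex.I / 4)

/-- Partial sum `F_{s,n}(x,t) = Σ_{k=1}^{n} e^{iπk²x + 2πikt}/k^s`. -/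
def Fpart (s : ℝ) (n : ℕ) (x t : ℝ) : ℂ :=
  ∑ k ∈ Finset.Icc 1 n,
    Complex.exp (Real.pi * Complex.I * (k : ℂ) ^ 2 * (x : ℂ)
        + 2 * Real.pi * Complex.I * (k : ℂ) * (t : ℂ)) / (k : ℂ) ^ (s : ℂ)

/-- The function `I_s(x,t)` (for `x > 0`). -/
def Ifun (s x t : ℝ) : ℂ :=
  (∫ u : ℝ, ρ *
      (Complex.exp (Real.pi * Complex.I * ((1 : ℂ) / 2 + ρ * (u : ℂ)) ^ 2 * (x : ℂ)
            + 2 * Real.pi * Complex.I * ((1 : ℂ) / 2 + ρ * (u : ℂ)) * (Int.fract t : ℝ)) /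
        (((1 : ℂ) / 2 + ρ * (u : ℂ)) ^ (s : ℂ) *
          (1 - Complex.exp (2 * Real.pi * Complex.I * ((1 : ℂ) / 2 + ρ * (u : ℂ)))))))
  + ρ * (x : ℂ) ^ (s : ℂ) *
    ∫ u : ℝ, (Real.exp (-(Real.pi * x * u ^ 2)) : ℝ) *
      ∑' k : ℕ, Complex.exp (-(Real.pi * Complex.I * (((k : ℂ) + 1) - (Int.fract t : ℝ)) ^ 2 / (x : ℂ))) *
        (((ρ * (x : ℂ) * (u : ℂ) + ((k : ℂ) + 1) - (Int.fract t : ℝ)) ^ (s : ℂ))⁻¹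
          - (((k : ℂ) + 1) ^ (s : ℂ))⁻¹)

/-- `Ω_s(x,t)`. -/
def Omega (s x t : ℝ) : ℂ :=
  if 0 < x then Ifun s x t else (starRingEnd ℂ) (Ifun s (-x) (-t))

/-- `Ω_s(x) = Ω_s(x,0)`. -/
def Omega0 (s x : ℝ) : ℂ := Omega s x 0

/-- The map `T(x) = -1/x mod 2`, valued in `(-1,1]`. -/
def Tmap (x : ℝ) : ℝ := -1 / x - 2 * ⌈((-1 / x) - 1) / 2⌉

/-- Denominator `Q_n` of the `n`-th convergent of the regular continued fraction of `x`. -/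
def Qden (x : ℝ) (n : ℕ) : ℝ := (GenContFract.of x).dens n

end

open scoped Topology

/-- `Tmap` takes values in `(-1, 1]`. -/
theorem Tmap_mem_Ioc (x : ℝ) : Tmap x ∈ Set.Ioc (-1 : ℝ) 1 := by
  have h1 := Int.le_ceil ((-1 / x - 1) / 2)
  have h2 := Int.ceil_lt_add_one ((-1 / x - 1) / 2)
  unfold Tmap
  constructor <;> linarith

theorem irrational_Tmap {x : ℝ} (hx : Irrational x) : Irrational (Tmap x) := by
  have h := (hx.inv.neg).sub_intCast (2 * ⌈(-1 / x - 1) / 2⌉)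
  have e : Tmap x = -x⁻¹ - ((2 * ⌈(-1 / x - 1) / 2⌉ : ℤ) : ℝ) := by
    unfold Tmap
    push_cast
    ring
  rwa [e]

theorem Tmap_of_half_lt {x : ℝ} (h1 : 1 / 2 < x) (h2 : x < 1) : Tmap x = 2 - 1 / x := by
  have h3 : 1 < 1 / x := by rw [lt_div_iff₀ (by linarith)]; linarith
  have h4 : 1 / x < 2 := by rw [div_lt_iff₀ (by linarith)]; linarith
  have h5 : ⌈(-1 / x - 1) / 2⌉ = -1 := by
    rw [Int.ceil_eq_iff, neg_div]
    constructor <;> push_cast <;> linarith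
  unfold Tmap
  rw [h5]
  push_cast
  ring

theorem Tmap_of_lt_neg_half {x : ℝ} (h1 : x < -(1 / 2)) (h2 : -1 < x) :
    Tmap x = -2 - 1 / x := by
  have h3 : 1 < -1 / x := by rw [lt_div_iff_of_neg (by linarith)]; linarith
  have h4 : -1 / x < 2 := by rw [div_lt_iff_of_neg (by linarith)]; linarith
  have h5 : ⌈(-1 / x - 1) / 2⌉ = 1 := by
    rw [Int.ceil_eq_iff]
    constructor <;> push_cast <;> linarith
  unfold Tmap
  rw [h5]
  push_cast
  ring

/-- Near the parabolic points `±1`, `Tmap` preserves signs and moves points towards `0`. -/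
theorem Tmap_of_half_lt_abs {x : ℝ} (h1 : 1 / 2 < |x|) (h2 : |x| < 1) :
    Real.sign (Tmap x) = Real.sign x ∧ |Tmap x| ≤ |x| := by
  rcases lt_abs.1 h1 with h | h
  · rw [abs_of_pos (by linarith : 0 < x)] at h2 ⊢
    have h4 : 1 / x < 2 := by rw [div_lt_iff₀ (by linarith)]; linarith
    have h5 : 2 - x ≤ 1 / x := by
      rw [le_div_iff₀ (by linarith)]; nlinarith [sq_nonneg (x - 1)]
    rw [Tmap_of_half_lt h h2, Real.sign_of_pos (by linarith), Real.sign_of_pos (by linarith),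
      abs_of_pos (by linarith)]
    exact ⟨rfl, by linarith⟩
  · rw [abs_of_neg (by linarith : x < 0)] at h2 ⊢
    have h4 : -2 < 1 / x := by rw [lt_div_iff_of_neg (by linarith)]; linarith
    have h5 : 1 / x ≤ -2 - x := by
      rw [div_le_iff_of_neg (by linarith)]; nlinarith [sq_nonneg (x + 1)]
    rw [Tmap_of_lt_neg_half (by linarith) (by linarith), Real.sign_of_neg (by linarith),
      Real.sign_of_neg (by linarith), abs_of_neg (by linarith)]
    exact ⟨rfl, by linarith⟩

theorem irrational_iterate_Tmap {x : ℝ} (hirr : Irrational x) (j : ℕ) :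
    Irrational (Tmap^[j] x) := by
  induction j with
  | zero => exact hirr
  | succ j ih => rw [Function.iterate_succ_apply']; exact irrational_Tmap ih

theorem abs_iterate_Tmap_lt_one {x : ℝ} (hx : |x| < 1) (hirr : Irrational x) (j : ℕ) :
    |Tmap^[j] x| < 1 := by
  cases j with
  | zero => exact hx
  | succ j =>
    have h := irrational_iterate_Tmap hirr (j + 1)
    rw [Function.iterate_succ_apply'] at h ⊢
    have hm := Tmap_mem_Ioc (Tmap^[j] x)
    exact abs_lt.2 ⟨hm.1, lt_of_le_of_ne hm.2 h.ne_one⟩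

/-- The iterates of `Tmap` do not tend to `±1`. -/
theorem not_tendsto_abs_iterate_Tmap_one {x : ℝ} (hx : |x| < 1) (hirr : Irrational x) :
    ¬ Tendsto (fun j : ℕ => |Tmap^[j] x|) atTop (𝓝 1) := by
  intro h
  obtain ⟨N, hN⟩ := eventually_atTop.1 (h.eventually_const_lt (by norm_num : (1 / 2 : ℝ) < 1))
  have hle : ∀ j ≥ N, |Tmap^[j] x| ≤ |Tmap^[N] x| := fun j hj => by
    induction j, hj using Nat.le_induction with
    | base => exact le_rfl
    | succ j hj ih =>
      rw [Function.iterate_succ_apply']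
      exact (Tmap_of_half_lt_abs (hN j hj) (abs_iterate_Tmap_lt_one hx hirr j)).2.trans ih
  have := le_of_tendsto h (eventually_atTop.2 ⟨N, hle⟩)
  linarith [abs_iterate_Tmap_lt_one hx hirr N]

/-- A bounded function that is differentiable at `s` is Lipschitz at `s`. -/
theorem exists_norm_sub_le_mul_abs_sub {E : Type*} [NormedAddCommGroup E] [NormedSpace ℝ E]
    {f : ℝ → E} {S : Set ℝ} {s M : ℝ} (hs : s ∈ S)
    (hM : ∀ y ∈ S, ‖f y‖ ≤ M) (hd : DifferentiableAt ℝ f s) :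
    ∃ C, 0 ≤ C ∧ ∀ t ∈ S, ‖f t - f s‖ ≤ C * |t - s| := by
  obtain ⟨c, hc, hO⟩ := hd.isBigO_sub.exists_pos
  obtain ⟨δ, hδ, hball⟩ := Metric.eventually_nhds_iff.1 hO.bound
  have hM0 : 0 ≤ M := (norm_nonneg _).trans (hM s hs)
  have hq : 0 ≤ 2 * M / δ := by positivity
  refine ⟨c + 2 * M / δ, by positivity, fun t ht => ?_⟩
  rcases lt_or_ge (dist t s) δ with h | h
  · refine (hball h).trans ?_
    rw [Real.norm_eq_abs]
    gcongr
    linarith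
  · rw [Real.dist_eq] at h
    calc ‖f t - f s‖ ≤ 2 * M := by linarith [norm_sub_le (f t) (f s), hM t ht, hM s hs]
      _ = 2 * M / δ * δ := by field_simp
      _ ≤ (c + 2 * M / δ) * |t - s| := by gcongr; linarith

/-- Bounded functions differentiable at `±1` are controlled by their values at `±1`. -/
theorem exists_norm_sub_sign_le {Ω : ℝ → ℂ} {M : ℝ} (hM : ∀ y ∈ Set.Icc (-1 : ℝ) 1, ‖Ω y‖ ≤ M)
    (hd1 : DifferentiableAt ℝ Ω 1) (hdm1 : DifferentiableAt ℝ Ω (-1)) :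
    ∃ C, ∀ t : ℝ, t ≠ 0 → |t| < 1 → ‖Ω t - Ω (Real.sign t)‖ ≤ C * (1 - |t|) := by
  obtain ⟨C, hC, h1⟩ := exists_norm_sub_le_mul_abs_sub (by simp) hM hd1
  obtain ⟨C', hC', h2⟩ := exists_norm_sub_le_mul_abs_sub (by simp) hM hdm1
  refine ⟨C + C', fun t ht ht1 => ?_⟩
  have hmem : t ∈ Set.Icc (-1 : ℝ) 1 := abs_le.1 ht1.le
  rcases lt_or_gt_of_ne ht with h | h
  · rw [Real.sign_of_neg h]
    have e : |t - -1| = 1 - |t| := by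
      rw [abs_of_neg h, abs_of_nonneg (by linarith [hmem.1])]; ring
    refine (h2 t hmem).trans ?_
    rw [e]
    gcongr
    linarith
  · rw [Real.sign_of_pos h]
    have e : |t - 1| = 1 - |t| := by
      rw [abs_of_pos h, abs_of_nonpos (by linarith [hmem.2])]; ring
    refine (h1 t hmem).trans ?_
    rw [e]
    gcongr
    linarith

theorem exists_one_sub_le_mul_one_sub_rpow {α : ℝ} (hα : 0 < α) :
    ∃ K, ∀ t : ℝ, 0 < t → t ≤ 1 → 1 - t ≤ K * (1 - t ^ α) := by
  rcases le_total α 1 with h | h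
  · refine ⟨α⁻¹, fun t h0 h1 => ?_⟩
    have := rpow_one_add_le_one_add_mul_self (s := t - 1) (by linarith) hα.le h
    rw [add_sub_cancel] at this
    rw [inv_mul_eq_div, le_div_iff₀ hα]
    linarith
  · refine ⟨1, fun t h0 h1 => ?_⟩
    have := Real.rpow_le_rpow_of_exponent_ge h0 h1 h
    rw [Real.rpow_one] at this
    linarith

/-- An antitone nonnegative sequence has summable decrements. -/
theorem Antitone.summable_sub_succ {A : ℕ → ℝ} (hA : Antitone A) (h0 : ∀ n, 0 ≤ A n) :
    Summable fun n => A n - A (n + 1) := by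
  refine summable_of_sum_range_le (c := A 0) (fun n => sub_nonneg.2 (hA n.le_succ)) fun n => ?_
  rw [Finset.sum_range_sub']
  linarith [h0 n]

/-- Summation by parts: if the unimodular phases `w` turn by factors `u j`
bounded away from `1`, expressed by `c j * (u j - 1)`, and the weights `A` decrease to `0`,
then `∑ w j * A j * b j` converges. -/
theorem exists_tendsto_sum_of_phase {A : ℕ → ℝ} {w u b b' c : ℕ → ℂ} {B : ℝ}
    (hA : Antitone A) (hA0 : Tendsto A atTop (𝓝 0)) (hw : ∀ j, ‖w j‖ = 1)
    (hwu : ∀ j, w (j + 1) = w j * u j) (hc : ∀ j, c j * (u j - 1) = b' j)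
    (hcB : ∀ j, ‖c j‖ ≤ B) (hb : Summable fun j => A j * ‖b j - b' j‖)
    (hcc : Summable fun j => A j * ‖c j - c (j + 1)‖) :
    ∃ L, Tendsto (fun N : ℕ => ∑ j ∈ Finset.range N, w j * A j * b j) atTop (𝓝 L) := by
  have hpos : ∀ j, 0 ≤ A j := fun j => hA.le_of_tendsto hA0 j
  have hs1 : Summable fun j => w j * A j * (b j - b' j) := by
    refine Summable.of_norm (hb.congr fun j => ?_)
    rw [norm_mul, norm_mul, hw, one_mul, Complex.norm_of_nonneg (hpos j)]
  have hs2 : Summable fun j => w (j + 1) * (A j * c j - A (j + 1) * c (j + 1)) := by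
    refine Summable.of_norm_bounded (hcc.add ((hA.summable_sub_succ hpos).mul_right B)) fun j => ?_
    have e : (A j * c j - A (j + 1) * c (j + 1) : ℂ)
        = A j * (c j - c (j + 1)) + ((A j - A (j + 1) : ℝ) : ℂ) * c (j + 1) := by
      push_cast
      ring
    have hd : 0 ≤ A j - A (j + 1) := sub_nonneg.2 (hA j.le_succ)
    rw [norm_mul, hw, one_mul, e]
    refine (norm_add_le _ _).trans ?_
    rw [norm_mul, norm_mul, Complex.norm_of_nonneg (hpos j), Complex.norm_of_nonneg hd]
    gcongr
    exact hcB _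
  have hg : Tendsto (fun N => (A N : ℂ) * w N * c N) atTop (𝓝 0) := by
    refine squeeze_zero_norm (a := fun N => A N * B) (fun N => ?_) (by simpa using hA0.mul_const B)
    rw [norm_mul, norm_mul, hw, mul_one, Complex.norm_of_nonneg (hpos N)]
    exact mul_le_mul_of_nonneg_left (hcB N) (hpos N)
  refine ⟨_, ((hs1.hasSum.tendsto_sum_nat.add hs2.hasSum.tendsto_sum_nat).add
    (hg.sub_const ((A 0 : ℂ) * w 0 * c 0))).congr fun N => ?_⟩
  rw [← Finset.sum_range_sub (fun N => (A N : ℂ) * w N * c N), ← Finset.sum_add_distrib,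
    ← Finset.sum_add_distrib]
  refine Finset.sum_congr rfl fun j _ => ?_
  rw [← hc j, hwu j]
  ring

/-- The weights `(∏ |T^ℓ x|)^α` decrease to `0`, and their products with `1 - |T^j x|` are
summable. -/
theorem antitone_tendsto_summable_prod_abs_iterate_Tmap {x α : ℝ} (hα : 0 < α) (hx : |x| < 1)
    (hirr : Irrational x) {A : ℕ → ℝ}
    (hAdef : ∀ j, A j = (∏ ℓ ∈ Finset.range j, |Tmap^[ℓ] x|) ^ α) :
    Antitone A ∧ Tendsto A atTop (𝓝 0) ∧ Summable fun j => A j * (1 - |Tmap^[j] x|) := by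
  have hlt := abs_iterate_Tmap_lt_one hx hirr
  have hpos : ∀ j, 0 < |Tmap^[j] x| := fun j => abs_pos.2 (irrational_iterate_Tmap hirr j).ne_zero
  have hA0 : ∀ j, 0 ≤ A j := fun j => by
    rw [hAdef]; positivity
  have hsucc : ∀ j, A (j + 1) = A j * |Tmap^[j] x| ^ α := fun j => by
    rw [hAdef, hAdef, Finset.prod_range_succ, Real.mul_rpow (by positivity) (by positivity)]
  have hanti : Antitone A := antitone_nat_of_succ_le fun j => by
    rw [hsucc]
    exact mul_le_of_le_one_right (hA0 j) (Real.rpow_le_one (hpos j).le (hlt j).le hα.le)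
  obtain ⟨K, hK⟩ := exists_one_sub_le_mul_one_sub_rpow hα
  have hsum : Summable fun j => A j * (1 - |Tmap^[j] x|) := by
    refine Summable.of_nonneg_of_le (fun j => mul_nonneg (hA0 j) (by linarith [hlt j]))
      (fun j => ?_) ((hanti.summable_sub_succ hA0).mul_left K)
    calc A j * (1 - |Tmap^[j] x|) ≤ A j * (K * (1 - |Tmap^[j] x| ^ α)) :=
          mul_le_mul_of_nonneg_left (hK _ (hpos j) (hlt j).le) (hA0 j)
      _ = K * (A j - A (j + 1)) := by rw [hsucc]; ring
  refine ⟨hanti, ?_, hsum⟩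
  have hlim := tendsto_atTop_ciInf hanti ⟨0, Set.forall_mem_range.2 hA0⟩
  rcases eq_or_ne (⨅ j, A j) 0 with h | h
  · rwa [h] at hlim
  · refine absurd ?_ (not_tendsto_abs_iterate_Tmap_one hx hirr)
    have h1 := (tendsto_const_nhds (x := (1 : ℝ))).sub (hsum.tendsto_atTop_zero.div hlim h)
    rw [zero_div, sub_zero] at h1
    refine h1.congr fun j => ?_
    have : A j ≠ 0 := by
      rw [hAdef]
      exact (Real.rpow_pos_of_pos (Finset.prod_pos fun ℓ _ => hpos ℓ) α).ne'
    simp only [Pi.div_apply]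
    field_simp
    ring

theorem exp_pi_mul_I_div_four_mul_sign_ne_one {t : ℝ} (ht : t ≠ 0) :
    Complex.exp (Real.pi * Complex.I / 4 * (Real.sign t : ℂ)) ≠ 1 := by
  intro h
  have h2 := congrArg Complex.re h
  have e : (Real.pi * Complex.I / 4 * (Real.sign t : ℂ) : ℂ)
      = ((Real.pi / 4 * Real.sign t : ℝ) : ℂ) * Complex.I := by
    push_cast
    ring
  rw [e, Complex.exp_ofReal_mul_I_re, Complex.one_re] at h2
  have hs : Real.cos (Real.pi / 4 * Real.sign t) = √2 / 2 := by
    rcases Real.sign_apply_eq_of_ne_zero t ht with h | h <;> simp [h, Real.cos_neg]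
  rw [hs] at h2
  have : √2 < 2 := by
    rw [Real.sqrt_lt' (by norm_num)]; norm_num
  linarith

/-- convergence of the twisted series for any bounded `Ω` differentiable
at `±1`. -/
theorem stmt17 (Ω : ℝ → ℂ) (hbdd : ∃ M : ℝ, ∀ y ∈ Set.Icc (-1 : ℝ) 1, ‖Ω y‖ ≤ M)
    (hd1 : DifferentiableAt ℝ Ω 1) (hdm1 : DifferentiableAt ℝ Ω (-1))
    (α : ℝ) (hα : 0 < α) (x : ℝ) (hx : x ∈ Set.Ioo (0 : ℝ) 1) (hirr : Irrational x) :
    ∃ L : ℂ, Tendsto (fun N : ℕ => ∑ j ∈ Finset.Icc 1 N,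
      Complex.exp (Real.pi * Complex.I / 4
          * ((∑ ℓ ∈ Finset.range j, Real.sign (Tmap^[ℓ] x) : ℝ) : ℂ))
        * (((∏ ℓ ∈ Finset.range j, |Tmap^[ℓ] x|) ^ α : ℝ) : ℂ)
        * Ω (Tmap^[j] x)) atTop (𝓝 L) := by
  obtain ⟨M, hM⟩ := hbdd
  have hx1 : |x| < 1 := abs_lt.2 ⟨by linarith [hx.1], hx.2⟩
  have hne : ∀ j, Tmap^[j] x ≠ 0 := fun j => (irrational_iterate_Tmap hirr j).ne_zero
  have hlt := abs_iterate_Tmap_lt_one hx1 hirr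
  obtain ⟨C, hC⟩ := exists_norm_sub_sign_le hM hd1 hdm1
  set A : ℕ → ℝ := fun j => (∏ ℓ ∈ Finset.range j, |Tmap^[ℓ] x|) ^ α with hAdef
  obtain ⟨hanti, hA0, hsum⟩ :=
    antitone_tendsto_summable_prod_abs_iterate_Tmap hα hx1 hirr (A := A) fun _ => rfl
  have hpos : ∀ j, 0 ≤ A j := fun j => hanti.le_of_tendsto hA0 j
  set w : ℕ → ℂ := fun j => Complex.exp (Real.pi * Complex.I / 4
    * ((∑ ℓ ∈ Finset.range j, Real.sign (Tmap^[ℓ] x) : ℝ) : ℂ)) with hwdef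
  set c : ℝ → ℂ := fun s => Ω s / (Complex.exp (Real.pi * Complex.I / 4 * (s : ℂ)) - 1)
  have hcB : ∀ j, ‖c (Real.sign (Tmap^[j] x))‖ ≤ ‖c 1‖ + ‖c (-1)‖ := fun j => by
    rcases Real.sign_apply_eq_of_ne_zero _ (hne j) with h | h <;> rw [h] <;> simp
  obtain ⟨L, hL⟩ := exists_tendsto_sum_of_phase (A := A) (w := w)
    (u := fun j => Complex.exp (Real.pi * Complex.I / 4 * (Real.sign (Tmap^[j] x) : ℂ)))
    (b := fun j => Ω (Tmap^[j] x)) (b' := fun j => Ω (Real.sign (Tmap^[j] x)))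
    (c := fun j => c (Real.sign (Tmap^[j] x))) (B := ‖c 1‖ + ‖c (-1)‖) hanti hA0
    (fun j => by
      have e : (Real.pi * Complex.I / 4
          * ((∑ ℓ ∈ Finset.range j, Real.sign (Tmap^[ℓ] x) : ℝ) : ℂ) : ℂ)
          = ((Real.pi / 4 * ∑ ℓ ∈ Finset.range j, Real.sign (Tmap^[ℓ] x) : ℝ) : ℂ)
            * Complex.I := by
        push_cast
        ring
      simp only [hwdef]
      rw [e, Complex.norm_exp_ofReal_mul_I])
    (fun j => by
      simp only [hwdef]
      rw [← Complex.exp_add, Finset.sum_range_succ, Complex.ofReal_add, mul_add])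
    (fun j => div_mul_cancel₀ _ (sub_ne_zero.2 (exp_pi_mul_I_div_four_mul_sign_ne_one (hne j))))
    hcB
    (Summable.of_nonneg_of_le (fun j => mul_nonneg (hpos j) (norm_nonneg _))
      (fun j => (mul_le_mul_of_nonneg_left (hC _ (hne j) (hlt j)) (hpos j)).trans_eq
        (mul_left_comm _ _ _)) (hsum.mul_left C))
    (Summable.of_nonneg_of_le (fun j => mul_nonneg (hpos j) (norm_nonneg _)) (fun j => by
      rw [mul_left_comm]
      refine mul_le_mul_of_nonneg_left ?_ (hpos j)
      have hB : 0 ≤ ‖c 1‖ + ‖c (-1)‖ := by positivity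
      rcases lt_or_ge (1 / 2) |Tmap^[j] x| with h | h
      · rw [Function.iterate_succ_apply', (Tmap_of_half_lt_abs h (hlt j)).1, sub_self, norm_zero]
        exact mul_nonneg (mul_nonneg zero_le_four hB) (by linarith [hlt j])
      · have := norm_sub_le (c (Real.sign (Tmap^[j] x))) (c (Real.sign (Tmap^[j + 1] x)))
        nlinarith [hcB j, hcB (j + 1)])
      (hsum.mul_left (4 * (‖c 1‖ + ‖c (-1)‖))))
  refine ⟨L - w 0 * A 0 * Ω x,
    (((tendsto_add_atTop_iff_nat 1).2 hL).sub_const _).congr fun N => ?_⟩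
  rw [Finset.range_eq_Ico, Finset.sum_eq_sum_Ico_succ_bot N.succ_pos]
  simp [hwdef, hAdef, ← Finset.Ico_add_one_right_eq_Icc]
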